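/- Let t > 0 and let ϱ be a probability density on ℝ^d that is more log-concave than the Gaussian N(0, t^{−1} I_d), with invertible covariance matrix Q. Then for every integer q ≥ 3, (q/2) · Σ_{a=0}^{q−2} T_ϱ( Q^{a}, Q^{q−2−a}, I_d ) ≤ (2q²/t) · tr( Q^{q} ). -/

import Mathlib

open MeasureTheory Filter Matrix

noncomputable section

/-- Mass of a set under a density. -/
def setMass {d : ℕ} (p : EuclideanSpace ℝ (Fin d) → ℝ) (S : Set (EuclideanSpace ℝ (Fin d))) : ℝ :=
  ∫ x in S, p x

/-- `p` is a log-concave probability density on `ℝ^d`. -/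
def IsLogConcaveDensity {d : ℕ} (p : EuclideanSpace ℝ (Fin d) → ℝ) : Prop :=
  (∀ x, 0 ≤ p x) ∧ (∫ x, p x = 1) ∧
    ∀ x y : EuclideanSpace ℝ (Fin d), ∀ t : ℝ, t ∈ Set.Icc (0:ℝ) 1 →
      p (t • x + (1 - t) • y) ≥ p x ^ t * p y ^ (1 - t)

/-- Boundary measure `p⁺(∂S)`. -/
def boundaryMeasure {d : ℕ} (p : EuclideanSpace ℝ (Fin d) → ℝ)
    (S : Set (EuclideanSpace ℝ (Fin d))) : ℝ :=
  Filter.liminf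
    (fun ε : ℝ => (setMass p {x | Metric.infDist x S ≤ ε} - setMass p S) / ε)
    (nhdsWithin 0 (Set.Ioi 0))

/-- Isoperimetric coefficient. -/
def isoperiCoeff {d : ℕ} (p : EuclideanSpace ℝ (Fin d) → ℝ) : ℝ :=
  sInf { r | ∃ S : Set (EuclideanSpace ℝ (Fin d)), MeasurableSet S ∧
    0 < setMass p S ∧ setMass p S < 1 ∧
    r = boundaryMeasure p S / min (setMass p S) (setMass p Sᶜ) }

/-- Mean of a density. -/
def densMean {d : ℕ} (p : EuclideanSpace ℝ (Fin d) → ℝ) : EuclideanSpace ℝ (Fin d) :=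
  ∫ x, p x • x

/-- Covariance matrix of a density. -/
def covMatrix {d : ℕ} (p : EuclideanSpace ℝ (Fin d) → ℝ) : Matrix (Fin d) (Fin d) ℝ :=
  Matrix.of fun i j => ∫ x, p x * ((x i - densMean p i) * (x j - densMean p j))

/-- Spectral norm of a matrix. -/
def specNorm {d : ℕ} (A : Matrix (Fin d) (Fin d) ℝ) : ℝ :=
  ‖Matrix.toEuclideanCLM (𝕜 := ℝ) A‖

/-- The KLS infimum constant over dimension `k`. -/
def psiDim (k : ℕ) : ℝ :=
  sInf { r | ∃ p : EuclideanSpace ℝ (Fin k) → ℝ, IsLogConcaveDensity p ∧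
    HasCompactSupport p ∧ r = isoperiCoeff p * Real.sqrt (specNorm (covMatrix p)) }

/-- Real power of a symmetric matrix through its spectral decomposition. -/
def matRpow {d : ℕ} (A : Matrix (Fin d) (Fin d) ℝ) (r : ℝ) : Matrix (Fin d) (Fin d) ℝ :=
  if hA : A.IsHermitian then
    (hA.eigenvectorUnitary : Matrix (Fin d) (Fin d) ℝ) *
      Matrix.diagonal (fun i => hA.eigenvalues i ^ r) *
      (star (hA.eigenvectorUnitary : Matrix (Fin d) (Fin d) ℝ))
  else 0

/-- The 3-tensor `T_p(A,B,C)` of a density. -/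
def ttensor {d : ℕ} (p : EuclideanSpace ℝ (Fin d) → ℝ)
    (A B C : Matrix (Fin d) (Fin d) ℝ) : ℝ :=
  ∫ x : EuclideanSpace ℝ (Fin d), ∫ y : EuclideanSpace ℝ (Fin d),
    p x * p y *
      (((fun i => x i - densMean p i) ⬝ᵥ A.mulVec (fun i => y i - densMean p i)) *
       ((fun i => x i - densMean p i) ⬝ᵥ B.mulVec (fun i => y i - densMean p i)) *
       ((fun i => x i - densMean p i) ⬝ᵥ C.mulVec (fun i => y i - densMean p i)))

/-- `p` is more log-concave than `N(0, τ⁻¹ I_d)`. -/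
def IsMoreLogConcaveThanGauss {d : ℕ} (τ : ℝ) (p : EuclideanSpace ℝ (Fin d) → ℝ) : Prop :=
  (∀ x, 0 ≤ p x) ∧ (∫ x, p x = 1) ∧
    ∀ x y : EuclideanSpace ℝ (Fin d), ∀ t : ℝ, t ∈ Set.Icc (0:ℝ) 1 →
      p (t • x + (1 - t) • y) * Real.exp (τ * ‖t • x + (1 - t) • y‖ ^ 2 / 2) ≥
        (p x * Real.exp (τ * ‖x‖ ^ 2 / 2)) ^ t *
        (p y * Real.exp (τ * ‖y‖ ^ 2 / 2)) ^ (1 - t)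

end

open Set in
lemma volume_add_volume_le_of_isCompact {K L C : Set ℝ} (hK : IsCompact K) (hL : IsCompact L)
    (hK0 : K.Nonempty) (hL0 : L.Nonempty)
    (h : ∀ x ∈ K, ∀ y ∈ L, (2⁻¹ : ℝ) • (x + y) ∈ C) : volume K + volume L ≤ 2 * volume C := by
  obtain ⟨a, ha, hmax⟩ := hK.exists_isGreatest hK0
  obtain ⟨b, hb, hmin⟩ := hL.exists_isLeast hL0
  have hC : volume ((fun z : ℝ => 2⁻¹ * z) ⁻¹' C) = 2 * volume C := by
    rw [Real.volume_preimage_mul_left (by norm_num)]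
    norm_num
  rw [← hC, ← measure_inter_add_sdiff ((fun z : ℝ => 2⁻¹ * z) ⁻¹' C) (measurableSet_Iic (a := a + b))]
  refine add_le_add ?_ ?_
  · rw [← measure_preimage_add_right volume (-b) K]
    refine measure_mono fun z hz => ⟨?_, ?_⟩
    · have := h _ hz b hb
      simpa using this
    · have : z + -b ≤ a := hmax hz
      simp only [mem_Iic]
      linarith
  · rw [← measure_preimage_add_right volume (-a) L]
    have h0 : volume ((fun z => z + -a) ⁻¹' L) ≤ volume (((fun z => z + -a) ⁻¹' L) \ {a + b}) := by
      rw [measure_sdiff_null (by simp)]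
    refine h0.trans (measure_mono fun z hz => ⟨?_, ?_⟩)
    · have := h a ha _ hz.1
      simpa using this
    · have h1 : b ≤ z + -a := hmin hz.1
      have h2 : z ≠ a + b := hz.2
      simp only [mem_Iic, not_le]
      exact lt_of_le_of_ne (by linarith) h2.symm

open Set in
/-- The Brunn-Minkowski inequality on the line, for midpoints. -/
lemma volume_add_volume_le {A B C : Set ℝ} (hA : MeasurableSet A) (hB : MeasurableSet B)
    (hA0 : A.Nonempty) (hB0 : B.Nonempty)
    (h : ∀ x ∈ A, ∀ y ∈ B, (2⁻¹ : ℝ) • (x + y) ∈ C) : volume A + volume B ≤ 2 * volume C := by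
  obtain ⟨a, ha⟩ := hA0
  obtain ⟨b, hb⟩ := hB0
  have key : ∀ K ⊆ A, IsCompact K → ∀ L ⊆ B, IsCompact L →
      volume K + volume L ≤ 2 * volume C := by
    intro K hKA hK L hLB hL
    refine (add_le_add (measure_mono (subset_insert a K)) (measure_mono (subset_insert b L))).trans
      (volume_add_volume_le_of_isCompact (hK.insert a) (hL.insert b) (insert_nonempty _ _)
        (insert_nonempty _ _) fun x hx y hy => h x (insert_subset ha hKA hx) y
          (insert_subset hb hLB hy))
  rw [hA.measure_eq_iSup_isCompact, hB.measure_eq_iSup_isCompact]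
  simp only [iSup_and']
  refine ENNReal.biSup_add_biSup_le' (p := fun K => K ⊆ A ∧ IsCompact K)
    (q := fun K => K ⊆ B ∧ IsCompact K) ⟨∅, by simp⟩ ⟨∅, by simp⟩ ?_
  exact fun K hK L hL => key K hK.1 hK.2 L hL.1 hL.2

open Set ENNReal in
lemma lintegral_add_lintegral_le_of_iSup_eq_one {f g h : ℝ → ℝ≥0∞} (hf : Measurable f)
    (hg : Measurable g) (hh : Measurable h) (hf1 : ⨆ x, f x = 1) (hg1 : ⨆ x, g x = 1)
    (H : ∀ x y, f x * g y ≤ h ((2⁻¹ : ℝ) • (x + y)) ^ 2) :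
    (∫⁻ x, f x) + ∫⁻ x, g x ≤ 2 * ∫⁻ x, h x := by
  have layer : ∀ u : ℝ → ℝ≥0∞, Measurable u → (∀ x, u x ≤ 1) →
      ∫⁻ x, u x = ∫⁻ t in Ioi (0 : ℝ), volume {x | t < (u x).toReal} := by
    intro u hu hu1
    rw [← lintegral_eq_lintegral_meas_lt volume (ae_of_all _ fun x => toReal_nonneg)
      hu.ennreal_toReal.aemeasurable]
    exact lintegral_congr fun x => (ofReal_toReal (ne_top_of_le_ne_top one_ne_top (hu1 x))).symm
  have hf1' : ∀ x, f x ≤ 1 := fun x => hf1 ▸ le_iSup f x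
  have hg1' : ∀ x, g x ≤ 1 := fun x => hg1 ▸ le_iSup g x
  have hmeas : ∀ u : ℝ → ℝ≥0∞, Measurable fun t : ℝ => volume {x | t < (u x).toReal} := by
    intro u
    refine Antitone.measurable fun s t hst => measure_mono fun x hx => ?_
    exact lt_of_le_of_lt hst hx
  have hmin : ∫⁻ x, min (h x) 1 ≤ ∫⁻ x, h x := lintegral_mono fun x => min_le_left _ _
  refine le_trans ?_ (mul_le_mul_right hmin 2)
  rw [layer f hf hf1', layer g hg hg1', layer _ (hh.min measurable_const) fun x => min_le_right _ _,
    ← lintegral_add_left (hmeas f), ← lintegral_const_mul _ (hmeas _)]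
  refine setLIntegral_mono' measurableSet_Ioi fun t ht => ?_
  have ht : 0 < t := ht
  rcases lt_or_ge t 1 with ht1 | ht1
  · have hne : ∀ u : ℝ → ℝ≥0∞, (∀ x, u x ≤ 1) → ⨆ x, u x = 1 →
        {x | t < (u x).toReal}.Nonempty := by
      intro u hu1 hu
      have : ENNReal.ofReal t < ⨆ x, u x := by
        rw [hu]; exact ofReal_lt_one.2 ht1
      obtain ⟨x, hx⟩ := lt_iSup_iff.1 this
      exact ⟨x, (ofReal_lt_iff_lt_toReal ht.le (ne_top_of_le_ne_top one_ne_top (hu1 x))).1 hx⟩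
    refine volume_add_volume_le (measurableSet_lt measurable_const hf.ennreal_toReal)
      (measurableSet_lt measurable_const hg.ennreal_toReal) (hne f hf1' hf1) (hne g hg1' hg1) ?_
    intro x hx y hy
    have hx : t < (f x).toReal := hx
    have hy : t < (g y).toReal := hy
    have hmt : min (h ((2⁻¹ : ℝ) • (x + y))) 1 ≠ ∞ :=
      ne_top_of_le_ne_top one_ne_top (min_le_right _ _)
    rw [mem_ofPred_eq, ← ofReal_lt_iff_lt_toReal ht.le hmt, lt_min_iff]
    refine ⟨?_, ofReal_lt_one.2 ht1⟩
    rw [← ofReal_lt_iff_lt_toReal ht.le (ne_top_of_le_ne_top one_ne_top (hf1' x))] at hx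
    rw [← ofReal_lt_iff_lt_toReal ht.le (ne_top_of_le_ne_top one_ne_top (hg1' y))] at hy
    by_contra! hle
    refine (ENNReal.mul_lt_mul hx hy).not_ge ((H x y).trans ?_)
    rw [← sq]
    exact pow_le_pow_left₀ zero_le hle 2
  · have hem : ∀ u : ℝ → ℝ≥0∞, (∀ x, u x ≤ 1) → {x | t < (u x).toReal} = ∅ := by
      intro u hu
      refine eq_empty_of_forall_notMem fun x hx => ?_
      have h1 : (u x).toReal ≤ 1 := toReal_mono one_ne_top (hu x)
      have : t < (u x).toReal := hx
      linarith
    simp [hem f hf1', hem g hg1']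

/-- The Prékopa-Leindler inequality for midpoints, as a property of a measure. -/
def PrekopaLeindler {E : Type*} [AddCommGroup E] [Module ℝ E] [MeasurableSpace E]
    (μ : Measure E) : Prop :=
  ∀ f g h : E → ENNReal, Measurable f → Measurable g → Measurable h →
    (∀ x y, f x * g y ≤ h ((2⁻¹ : ℝ) • (x + y)) ^ 2) →
    (∫⁻ x, f x ∂μ) * ∫⁻ x, g x ∂μ ≤ (∫⁻ x, h x ∂μ) ^ 2

open ENNReal in
lemma ENNReal.four_mul_mul_le_add_sq (a b : ℝ≥0∞) : 4 * (a * b) ≤ (a + b) ^ 2 := by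
  rcases eq_or_ne a ∞ with rfl | ha
  · simp
  rcases eq_or_ne b ∞ with rfl | hb
  · simp
  lift a to NNReal using ha
  lift b to NNReal using hb
  norm_cast
  rw [← NNReal.coe_le_coe]
  push_cast
  nlinarith [sq_nonneg ((a : ℝ) - b)]

open ENNReal in
lemma lintegral_mul_lintegral_le_of_iSup_lt_top {f g h : ℝ → ℝ≥0∞} (hf : Measurable f)
    (hg : Measurable g) (hh : Measurable h) (hf1 : ⨆ x, f x ≠ ∞) (hg1 : ⨆ x, g x ≠ ∞)
    (H : ∀ x y, f x * g y ≤ h ((2⁻¹ : ℝ) • (x + y)) ^ 2) :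
    (∫⁻ x, f x) * ∫⁻ x, g x ≤ (∫⁻ x, h x) ^ 2 := by
  rcases eq_or_ne (⨆ x, f x) 0 with hf0 | hf0
  · simp [iSup_eq_zero.1 hf0]
  rcases eq_or_ne (⨆ x, g x) 0 with hg0 | hg0
  · simp [iSup_eq_zero.1 hg0]
  set a := ⨆ x, f x
  set b := ⨆ x, g x
  set c : ℝ≥0∞ := (a * b) ^ (2⁻¹ : ℝ) with hc
  have hc2 : c ^ 2 = a * b := by
    rw [hc, ← ENNReal.rpow_natCast, ← ENNReal.rpow_mul]; norm_num
  have hab0 : a * b ≠ 0 := mul_ne_zero hf0 hg0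
  have habt : a * b ≠ ∞ := mul_ne_top hf1 hg1
  have hinv : (c⁻¹) ^ 2 = a⁻¹ * b⁻¹ := by
    rw [← ENNReal.inv_pow, hc2, ENNReal.mul_inv (Or.inl hf0) (Or.inl hf1)]
  have key := lintegral_add_lintegral_le_of_iSup_eq_one (f := fun x => a⁻¹ * f x)
    (g := fun x => b⁻¹ * g x) (h := fun x => c⁻¹ * h x) (hf.const_mul _) (hg.const_mul _)
    (hh.const_mul _) (by rw [← mul_iSup]; exact ENNReal.inv_mul_cancel hf0 hf1)
    (by rw [← mul_iSup]; exact ENNReal.inv_mul_cancel hg0 hg1) (fun x y => by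
      rw [mul_pow, hinv, mul_mul_mul_comm]
      exact mul_le_mul_right (H x y) _)
  rw [lintegral_const_mul _ hf, lintegral_const_mul _ hg, lintegral_const_mul _ hh] at key
  have h2 := (ENNReal.four_mul_mul_le_add_sq _ _).trans (pow_le_pow_left₀ zero_le key 2)
  rw [mul_mul_mul_comm, mul_pow, mul_pow, hinv, ← ENNReal.mul_inv (Or.inl hf0) (Or.inl hf1)] at h2
  have h4 : (2 : ℝ≥0∞) ^ 2 = 4 := by norm_num
  rw [h4, ENNReal.mul_le_mul_iff_right (by norm_num) (by norm_num),
    ENNReal.mul_le_mul_iff_right (ENNReal.inv_ne_zero.2 habt) (ENNReal.inv_ne_top.2 hab0)] at h2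
  exact h2

open ENNReal in
lemma prekopaLeindler_real : PrekopaLeindler (volume : Measure ℝ) := by
  intro f g h hf hg hh H
  have hsup : ∀ u : ℝ → ℝ≥0∞, Measurable u → ∫⁻ x, u x = ⨆ n : ℕ, ∫⁻ x, min (u x) n := by
    intro u hu
    rw [← lintegral_iSup (fun n => hu.min measurable_const)]
    · refine lintegral_congr fun x => ?_
      rw [← inf_iSup_eq, ENNReal.iSup_natCast, inf_top_eq]
    · intro m n hmn x
      exact min_le_min_left _ (by exact_mod_cast hmn)
  rw [hsup f hf, hsup g hg, ENNReal.iSup_mul]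
  refine iSup_le fun m => ?_
  rw [ENNReal.mul_iSup]
  refine iSup_le fun n => ?_
  refine lintegral_mul_lintegral_le_of_iSup_lt_top (hf.min measurable_const)
    (hg.min measurable_const) hh ?_ ?_ ?_
  · exact ne_top_of_le_ne_top (natCast_ne_top m) (iSup_le fun x => min_le_right _ _)
  · exact ne_top_of_le_ne_top (natCast_ne_top n) (iSup_le fun x => min_le_right _ _)
  · exact fun x y => (mul_le_mul' (min_le_left _ _) (min_le_left _ _)).trans (H x y)

lemma PrekopaLeindler.prod {E F : Type*} [AddCommGroup E] [Module ℝ E] [MeasurableSpace E]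
    [AddCommGroup F] [Module ℝ F] [MeasurableSpace F] {μ : Measure E} {ν : Measure F}
    [SFinite ν] (hμ : PrekopaLeindler μ) (hν : PrekopaLeindler ν) :
    PrekopaLeindler (μ.prod ν) := by
  intro f g h hf hg hh H
  rw [lintegral_prod _ hf.aemeasurable, lintegral_prod _ hg.aemeasurable,
    lintegral_prod _ hh.aemeasurable]
  refine hμ _ _ _ hf.lintegral_prod_right' hg.lintegral_prod_right' hh.lintegral_prod_right' ?_
  intro x y
  refine hν _ _ _ (hf.comp measurable_prodMk_left) (hg.comp measurable_prodMk_left)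
    (hh.comp measurable_prodMk_left) ?_
  exact fun u v => H (x, u) (y, v)

lemma PrekopaLeindler.of_measurePreserving {E F : Type*} [AddCommGroup E] [Module ℝ E]
    [MeasurableSpace E] [AddCommGroup F] [Module ℝ F] [MeasurableSpace F] {μ : Measure E}
    {ν : Measure F} (hμ : PrekopaLeindler μ) {φ : E → F} (hφ : MeasurePreserving φ μ ν)
    (hlin : ∀ x y, φ ((2⁻¹ : ℝ) • (x + y)) = (2⁻¹ : ℝ) • (φ x + φ y)) : PrekopaLeindler ν := by
  intro f g h hf hg hh H
  rw [← hφ.lintegral_comp hf, ← hφ.lintegral_comp hg, ← hφ.lintegral_comp hh]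
  refine hμ _ _ _ (hf.comp hφ.measurable) (hg.comp hφ.measurable) (hh.comp hφ.measurable) ?_
  intro x y
  simp only [hlin]
  exact H _ _

lemma prekopaLeindler_pi : ∀ n : ℕ, PrekopaLeindler (volume : Measure (Fin n → ℝ))
  | 0 => by
    intro f g h _ _ _ H
    have := H default default
    simp only [lintegral_unique, Measure.volume_pi_eq_dirac (0 : Fin 0 → ℝ)] 
    simp only [measure_univ, mul_one]
    convert this
  | n + 1 => by
    refine (prekopaLeindler_real.prod (prekopaLeindler_pi n)).of_measurePreserving
      (volume_preserving_piFinSuccAbove (fun _ : Fin (n + 1) => ℝ) 0).symm ?_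
    intro x y
    ext i
    refine Fin.cases ?_ (fun j => ?_) i <;> simp [MeasurableEquiv.piFinSuccAbove, mul_add]

open ENNReal in
/-- The Prékopa-Leindler inequality for midpoints on Euclidean space. -/
theorem prekopaLeindler_euclideanSpace {d : ℕ} {f g h : EuclideanSpace ℝ (Fin d) → ℝ≥0∞}
    (hh : AEMeasurable h) (H : ∀ x y, f x * g y ≤ h ((2⁻¹ : ℝ) • (x + y)) ^ 2) :
    (∫⁻ x, f x) * ∫⁻ x, g x ≤ (∫⁻ x, h x) ^ 2 := by
  have hE : PrekopaLeindler (volume : Measure (EuclideanSpace ℝ (Fin d))) :=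
    (prekopaLeindler_pi d).of_measurePreserving
      (PiLp.volume_preserving_toLp (Fin d)) (fun x y => rfl)
  obtain ⟨f', hf', hff', hf⟩ := exists_measurable_le_lintegral_eq volume f
  obtain ⟨g', hg', hgg', hg⟩ := exists_measurable_le_lintegral_eq volume g
  obtain ⟨h', hh', hhh', hhe⟩ : ∃ h' : EuclideanSpace ℝ (Fin d) → ℝ≥0∞, Measurable h' ∧ h ≤ h' ∧
      h =ᵐ[volume] h' := by
    classical
    have hN : volume (toMeasurable volume {x | h x ≠ hh.mk h x}) = 0 := by
      rw [measure_toMeasurable]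
      exact hh.ae_eq_mk
    refine ⟨(toMeasurable volume {x | h x ≠ hh.mk h x}).piecewise (fun _ => ∞) (hh.mk h),
      measurable_const.piecewise (measurableSet_toMeasurable _ _) hh.measurable_mk, ?_, ?_⟩
    · intro x
      by_cases hx : x ∈ toMeasurable volume {x | h x ≠ hh.mk h x}
      · simp [hx]
      · have : h x = hh.mk h x := by
          by_contra hne
          exact hx (subset_toMeasurable _ _ hne)
        simp [hx, this]
    · filter_upwards [hh.ae_eq_mk, measure_eq_zero_iff_ae_notMem.1 hN] with x hx hx'
      simp [hx', hx]
  rw [hf, hg, lintegral_congr_ae hhe]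
  refine hE f' g' h' hf' hg' hh' fun x y => ?_
  exact (mul_le_mul' (hff' x) (hgg' y)).trans ((H x y).trans (pow_le_pow_left₀ zero_le (hhh' _) 2))

/-- The measure with a given density. -/
noncomputable def densMeasure {d : ℕ} (p : EuclideanSpace ℝ (Fin d) → ℝ) :
    Measure (EuclideanSpace ℝ (Fin d)) :=
  volume.withDensity fun x => ENNReal.ofReal (p x)

namespace IsMoreLogConcaveThanGauss

variable {d : ℕ} {t : ℝ} {p : EuclideanSpace ℝ (Fin d) → ℝ}

lemma integrable (hp : IsMoreLogConcaveThanGauss t p) : Integrable p := by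
  by_contra h
  have := hp.2.1
  rw [integral_undef h] at this
  exact zero_ne_one this

lemma aemeasurable (hp : IsMoreLogConcaveThanGauss t p) :
    AEMeasurable fun x => ENNReal.ofReal (p x) :=
  hp.integrable.aestronglyMeasurable.aemeasurable.ennreal_ofReal

lemma lintegral_eq_one (hp : IsMoreLogConcaveThanGauss t p) :
    ∫⁻ x, ENNReal.ofReal (p x) = 1 := by
  rw [← ofReal_integral_eq_lintegral_ofReal hp.integrable (ae_of_all _ hp.1), hp.2.1,
    ENNReal.ofReal_one]

lemma isProbabilityMeasure (hp : IsMoreLogConcaveThanGauss t p) :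
    IsProbabilityMeasure (densMeasure p) :=
  ⟨by rw [densMeasure, withDensity_apply _ MeasurableSet.univ, setLIntegral_univ,
    hp.lintegral_eq_one]⟩

lemma integral_densMeasure {F : Type*} [NormedAddCommGroup F] [NormedSpace ℝ F]
    (hp : IsMoreLogConcaveThanGauss t p) (f : EuclideanSpace ℝ (Fin d) → F) :
    ∫ x, f x ∂densMeasure p = ∫ x, p x • f x := by
  rw [densMeasure, integral_withDensity_eq_integral_toReal_smul₀ hp.aemeasurable
    (ae_of_all _ fun x => ENNReal.ofReal_lt_top)]
  simp only [ENNReal.toReal_ofReal (hp.1 _)]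

lemma mul_le_sq (hp : IsMoreLogConcaveThanGauss t p) (x y : EuclideanSpace ℝ (Fin d)) :
    p x * p y * Real.exp (t / 4 * ‖x - y‖ ^ 2) ≤ p ((2⁻¹ : ℝ) • (x + y)) ^ 2 := by
  have h := hp.2.2 x y 2⁻¹ ⟨by norm_num, by norm_num⟩
  have hhalf : (1 - 2⁻¹ : ℝ) = 2⁻¹ := by norm_num
  rw [hhalf, ← smul_add] at h
  set m := (2⁻¹ : ℝ) • (x + y)
  have hX : 0 ≤ p x * Real.exp (t * ‖x‖ ^ 2 / 2) := mul_nonneg (hp.1 x) (Real.exp_pos _).le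
  have hY : 0 ≤ p y * Real.exp (t * ‖y‖ ^ 2 / 2) := mul_nonneg (hp.1 y) (Real.exp_pos _).le
  rw [← Real.mul_rpow hX hY] at h
  have h2 := pow_le_pow_left₀ (Real.rpow_nonneg (mul_nonneg hX hY) _) h 2
  rw [← Real.rpow_natCast, ← Real.rpow_mul (mul_nonneg hX hY)] at h2
  norm_num at h2
  have hpar : ‖m‖ ^ 2 = (‖x‖ ^ 2 + ‖y‖ ^ 2) / 2 - ‖x - y‖ ^ 2 / 4 := by
    have h3 := parallelogram_law_with_norm ℝ x y
    have h4 : ‖m‖ = 2⁻¹ * ‖x + y‖ := by rw [norm_smul]; norm_num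
    rw [h4]
    linarith
  rw [mul_pow, ← Real.exp_nat_mul, hpar, mul_mul_mul_comm, ← Real.exp_add] at h2
  have hE := Real.exp_pos (-(t * ‖x‖ ^ 2 / 2 + t * ‖y‖ ^ 2 / 2) + t / 4 * ‖x - y‖ ^ 2)
  have h5 := mul_le_mul_of_nonneg_right h2 hE.le
  rw [mul_assoc, ← Real.exp_add, mul_assoc (p m ^ 2), ← Real.exp_add] at h5
  refine (le_of_eq ?_).trans (h5.trans (le_of_eq ?_))
  · congr 2; ring
  · convert mul_one _
    rw [Real.exp_eq_one_iff]
    push_cast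
    ring

open ENNReal in
/-- Maurey's property `(τ)` for strongly log-concave densities. -/
lemma lintegral_exp_mul_lintegral_exp_le (hp : IsMoreLogConcaveThanGauss t p)
    {f g : EuclideanSpace ℝ (Fin d) → ℝ} (hf : Measurable f) (hg : Measurable g)
    (H : ∀ x y, g x - f y ≤ t / 4 * ‖x - y‖ ^ 2) :
    (∫⁻ x, ENNReal.ofReal (Real.exp (g x)) ∂densMeasure p) *
      ∫⁻ x, ENNReal.ofReal (Real.exp (-f x)) ∂densMeasure p ≤ 1 := by
  have e : ∀ u : EuclideanSpace ℝ (Fin d) → ℝ, Measurable u →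
      ∫⁻ x, ENNReal.ofReal (Real.exp (u x)) ∂densMeasure p =
        ∫⁻ x, ENNReal.ofReal (p x * Real.exp (u x)) := by
    intro u hu
    rw [densMeasure, lintegral_withDensity_eq_lintegral_mul₀ hp.aemeasurable
      hu.exp.ennreal_ofReal.aemeasurable]
    simp only [Pi.mul_apply, ENNReal.ofReal_mul (hp.1 _)]
  rw [e g hg, e (fun x => -f x) hf.neg]
  refine (prekopaLeindler_euclideanSpace hp.aemeasurable fun x y => ?_).trans
    (by rw [hp.lintegral_eq_one, one_pow])
  rw [← ENNReal.ofReal_mul (mul_nonneg (hp.1 x) (Real.exp_pos _).le),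
    ← ENNReal.ofReal_pow (hp.1 _)]
  refine ENNReal.ofReal_le_ofReal (le_trans ?_ (hp.mul_le_sq x y))
  rw [mul_mul_mul_comm, ← Real.exp_add]
  exact mul_le_mul_of_nonneg_left (Real.exp_le_exp.2 (by linarith [H x y]))
    (mul_nonneg (hp.1 x) (hp.1 y))

lemma lintegral_exp_norm_sq_lt_top (ht : 0 < t) (hp : IsMoreLogConcaveThanGauss t p) :
    ∫⁻ x, ENNReal.ofReal (Real.exp (t / 8 * ‖x‖ ^ 2)) ∂densMeasure p < ⊤ := by
  have := hp.isProbabilityMeasure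
  have h := hp.lintegral_exp_mul_lintegral_exp_le (f := fun y => t / 4 * ‖y‖ ^ 2)
    (g := fun x => t / 8 * ‖x‖ ^ 2) (by fun_prop) (by fun_prop) fun x y => by
      have h1 : ‖x‖ ≤ ‖x - y‖ + ‖y‖ := by simpa using norm_add_le (x - y) y
      have h2 : ‖x‖ ^ 2 ≤ (‖x - y‖ + ‖y‖) ^ 2 := pow_le_pow_left₀ (norm_nonneg _) h1 2
      nlinarith [sq_nonneg (‖x - y‖ - ‖y‖)]
  refine lt_top_iff_ne_top.2 fun htop => ?_
  rw [htop, ENNReal.top_mul] at h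
  · simp at h
  · refine ((lintegral_pos_iff_support (by fun_prop)).2 ?_).ne'
    rw [Function.support_eq_univ fun x => (ENNReal.ofReal_pos.2 (Real.exp_pos _)).ne']
    simp

lemma integrable_of_hasTemperateGrowth (ht : 0 < t) (hp : IsMoreLogConcaveThanGauss t p)
    {f : EuclideanSpace ℝ (Fin d) → ℝ} (hf : f.HasTemperateGrowth) :
    Integrable f (densMeasure p) := by
  have := hp.isProbabilityMeasure
  obtain ⟨k, C, hC⟩ := hf.2 0
  have hexp : Integrable (fun x => Real.exp (t / 8 * ‖x‖ ^ 2)) (densMeasure p) := by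
    refine ⟨by fun_prop, ?_⟩
    rw [hasFiniteIntegral_iff_ofReal (ae_of_all _ fun x => (Real.exp_pos _).le)]
    exact hp.lintegral_exp_norm_sq_lt_top ht
  have hmom : Integrable (fun x : EuclideanSpace ℝ (Fin d) => ‖x‖ ^ (2 * k)) (densMeasure p) := by
    refine (hexp.const_mul ((t / 8) ^ k / k.factorial)⁻¹).mono' (by fun_prop)
      (ae_of_all _ fun x => ?_)
    have hpos : 0 < (t / 8) ^ k / (k.factorial : ℝ) := by positivity
    rw [Real.norm_of_nonneg (by positivity), ← div_eq_inv_mul, le_div_iff₀ hpos]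
    have := Real.pow_div_factorial_le_exp (t / 8 * ‖x‖ ^ 2) (by positivity) k
    calc _ = (t / 8 * ‖x‖ ^ 2) ^ k / k.factorial := by rw [mul_pow, ← pow_mul]; ring
      _ ≤ _ := this
  have hb : Integrable (fun x : EuclideanSpace ℝ (Fin d) => C * (2 ^ k * (1 + ‖x‖ ^ (2 * k))))
      (densMeasure p) := (((integrable_const 1).add hmom).const_mul _).const_mul _
  refine hb.mono' hf.1.continuous.aestronglyMeasurable (ae_of_all _ fun x => ?_)
  have h0 := hC x
  rw [norm_iteratedFDeriv_zero] at h0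
  have hC0 : 0 ≤ C := by
    have := hC 0
    simp at this
    exact (abs_nonneg _).trans this
  refine h0.trans (mul_le_mul_of_nonneg_left ?_ hC0)
  rcases le_total ‖x‖ 1 with h | h
  · calc (1 + ‖x‖) ^ k ≤ 2 ^ k := pow_le_pow_left₀ (by positivity) (by linarith) k
      _ ≤ 2 ^ k * (1 + ‖x‖ ^ (2 * k)) := le_mul_of_one_le_right (by positivity)
        (le_add_of_nonneg_right (by positivity))
  · calc (1 + ‖x‖) ^ k ≤ (2 * ‖x‖ ^ 2) ^ k :=
          pow_le_pow_left₀ (by positivity) (by nlinarith) k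
      _ = 2 ^ k * ‖x‖ ^ (2 * k) := by rw [mul_pow, pow_mul]
      _ ≤ _ := mul_le_mul_of_nonneg_left (by linarith) (by positivity)

end IsMoreLogConcaveThanGauss

lemma Real.one_add_add_sq_add_cube_le_exp (s : ℝ) :
    1 + s + s ^ 2 / 2 + s ^ 3 / 6 ≤ Real.exp s := by
  have h2 : Monotone fun s : ℝ => Real.exp s - (1 + s + s ^ 2 / 2) := by
    have hd : ∀ s : ℝ, HasDerivAt (fun s : ℝ => Real.exp s - (1 + s + s ^ 2 / 2))
        (Real.exp s - (1 + s)) s := fun s => by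
      exact ((Real.hasDerivAt_exp s).sub (((hasDerivAt_id s).const_add 1).add
        (((hasDerivAt_id s).pow 2).div_const 2))).congr_deriv (by simp)
    refine monotone_of_deriv_nonneg (fun s => (hd s).differentiableAt) fun s => ?_
    rw [(hd s).deriv]
    linarith [Real.add_one_le_exp s]
  have hd : ∀ s : ℝ, HasDerivAt (fun s : ℝ => Real.exp s - (1 + s + s ^ 2 / 2 + s ^ 3 / 6))
      (Real.exp s - (1 + s + s ^ 2 / 2)) s := fun s => by
    exact ((Real.hasDerivAt_exp s).sub ((((hasDerivAt_id s).const_add 1).add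
      (((hasDerivAt_id s).pow 2).div_const 2)).add
        (((hasDerivAt_id s).pow 3).div_const 6))).congr_deriv (by simp; ring)
  have hcont : Continuous fun s : ℝ => Real.exp s - (1 + s + s ^ 2 / 2 + s ^ 3 / 6) := by fun_prop
  have key : 0 ≤ Real.exp s - (1 + s + s ^ 2 / 2 + s ^ 3 / 6) := by
    rcases le_total 0 s with hs | hs
    · have hm : MonotoneOn (fun s : ℝ => Real.exp s - (1 + s + s ^ 2 / 2 + s ^ 3 / 6))
          (Set.Ici 0) := by
        refine monotoneOn_of_deriv_nonneg (convex_Ici 0) hcont.continuousOn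
          (fun x _ => (hd x).differentiableAt.differentiableWithinAt) fun x hx => ?_
        rw [interior_Ici] at hx
        rw [(hd x).deriv]
        simpa using h2 (le_of_lt hx)
      simpa using hm Set.self_mem_Ici hs hs
    · have hm : AntitoneOn (fun s : ℝ => Real.exp s - (1 + s + s ^ 2 / 2 + s ^ 3 / 6))
          (Set.Iic 0) := by
        refine antitoneOn_of_deriv_nonpos (convex_Iic 0) hcont.continuousOn
          (fun x _ => (hd x).differentiableAt.differentiableWithinAt) fun x hx => ?_
        rw [interior_Iic] at hx
        rw [(hd x).deriv]
        simpa using h2 (le_of_lt hx)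
      simpa using hm hs Set.self_mem_Iic hs
  linarith

lemma ofReal_integral_le_lintegral_ofReal_of_le {α : Type*} [MeasurableSpace α] {μ : Measure α}
    {u v : α → ℝ} (hu : Integrable u μ) (hv : Measurable v) (hv0 : ∀ x, 0 ≤ v x)
    (huv : ∀ x, u x ≤ v x) : ENNReal.ofReal (∫ x, u x ∂μ) ≤ ∫⁻ x, ENNReal.ofReal (v x) ∂μ := by
  rcases eq_or_ne (∫⁻ x, ENNReal.ofReal (v x) ∂μ) ⊤ with h | h
  · simp [h]
  have hvi : Integrable v μ := ⟨hv.aestronglyMeasurable, by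
    rw [hasFiniteIntegral_iff_ofReal (ae_of_all _ hv0)]
    exact lt_top_iff_ne_top.2 h⟩
  rw [← ofReal_integral_eq_lintegral_ofReal hvi (ae_of_all _ hv0)]
  exact ENNReal.ofReal_le_ofReal (integral_mono hu hvi huv)

lemma exp_second_order_lower_bound {c ε a b : ℝ} (hc : 0 ≤ c) (hε0 : 0 ≤ ε) (hε1 : ε ≤ 1) :
    1 + ε * a + ε ^ 2 * (a ^ 2 / 2 - c * b) - ε ^ 3 *
      (c * (a ^ 2 + b ^ 2) + ((2 * a ^ 2 + 2 * c ^ 2 * b ^ 2) +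
        (2 * a ^ 2 + 2 * c ^ 2 * b ^ 2) ^ 2)) ≤ Real.exp (ε * a - c * ε ^ 2 * b) := by
  refine le_trans ?_ (Real.one_add_add_sq_add_cube_le_exp _)
  set u := a - c * ε * b with hu
  set A := 2 * a ^ 2 + 2 * c ^ 2 * b ^ 2 with hA
  have e : ε * a - c * ε ^ 2 * b = ε * u := by rw [hu]; ring
  have hε2 : ε ^ 2 ≤ 1 := pow_le_one₀ hε0 hε1
  have hu2 : u ^ 2 ≤ A := by
    have h1 : u ^ 2 ≤ 2 * a ^ 2 + 2 * (c * ε * b) ^ 2 := by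
      rw [hu]; nlinarith [sq_nonneg (a + c * ε * b)]
    have h2 : (c * ε * b) ^ 2 ≤ c ^ 2 * b ^ 2 := by
      have : (c * ε * b) ^ 2 = ε ^ 2 * (c ^ 2 * b ^ 2) := by ring
      rw [this]
      exact mul_le_of_le_one_left (by positivity) hε2
    linarith
  have hA0 : 0 ≤ A := by positivity
  have hu3 : -(A + A ^ 2) ≤ u ^ 3 / 6 := by
    have h1 : (u ^ 2) ^ 2 ≤ A ^ 2 := pow_le_pow_left₀ (sq_nonneg u) hu2 2
    nlinarith [sq_nonneg (u * (u + 1)), sq_nonneg (u ^ 2), sq_nonneg u]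
  have hsq : a ^ 2 / 2 - ε * (c * (a ^ 2 + b ^ 2)) ≤ u ^ 2 / 2 := by
    have h1 : a * b ≤ a ^ 2 + b ^ 2 := by nlinarith [sq_nonneg (a - b), sq_nonneg a, sq_nonneg b]
    have h2 := mul_le_mul_of_nonneg_left h1 (mul_nonneg hε0 hc)
    rw [hu]
    nlinarith [sq_nonneg (c * ε * b)]
  have h3 := mul_le_mul_of_nonneg_left hu3 (pow_nonneg hε0 3)
  have h4 := mul_le_mul_of_nonneg_left hsq (pow_nonneg hε0 2)
  rw [e, mul_pow, mul_pow, ← e]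
  nlinarith

lemma ofReal_combination_le_lintegral_ofReal {α : Type*} [MeasurableSpace α] {μ : Measure α}
    [IsProbabilityMeasure μ] {f g h v : α → ℝ} (hf : Integrable f μ) (hg : Integrable g μ)
    (hh : Integrable h μ) (hv : Measurable v) (hv0 : ∀ x, 0 ≤ v x) (a b c : ℝ)
    (H : ∀ x, 1 + a * f x + b * g x - c * h x ≤ v x) :
    ENNReal.ofReal (1 + a * ∫ x, f x ∂μ + b * ∫ x, g x ∂μ - c * ∫ x, h x ∂μ) ≤
      ∫⁻ x, ENNReal.ofReal (v x) ∂μ := by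
  have i1 : Integrable (fun x => 1 + a * f x) μ := (integrable_const 1).add (hf.const_mul a)
  have i2 : Integrable (fun x => 1 + a * f x + b * g x) μ := i1.add (hg.const_mul b)
  have i3 : Integrable (fun x => 1 + a * f x + b * g x - c * h x) μ := i2.sub (hh.const_mul c)
  refine le_trans (ENNReal.ofReal_le_ofReal (le_of_eq ?_))
    (ofReal_integral_le_lintegral_ofReal_of_le i3 hv hv0 H)
  rw [integral_sub i2 (hh.const_mul c), integral_add i1 (hg.const_mul b),
    integral_add (integrable_const 1) (hf.const_mul a), integral_const_mul, integral_const_mul,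
    integral_const_mul]
  simp

namespace IsMoreLogConcaveThanGauss

variable {d : ℕ} {t : ℝ} {p : EuclideanSpace ℝ (Fin d) → ℝ}

lemma second_order_bound (ht : 0 < t) (hp : IsMoreLogConcaveThanGauss t p)
    {F G : EuclideanSpace ℝ (Fin d) → ℝ} (hF : F.HasTemperateGrowth) (hG : G.HasTemperateGrowth)
    (hG0 : ∀ x, 0 ≤ G x) {K : ℝ}
    (H : ∀ x y, F x - F y ≤ 2 * √(G x) * ‖x - y‖ + K * ‖x - y‖ ^ 2)
    (hF0 : ∫ x, F x ∂densMeasure p = 0) {c : ℝ} (hc : 0 < c) :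
    ∃ w r : ℝ, ∀ ε, 0 ≤ ε → ε ≤ 1 → ε * K ≤ t / 4 - 1 / c →
      ENNReal.ofReal (1 + ε ^ 2 * ((∫ x, F x ^ 2 ∂densMeasure p) / 2 -
          c * ∫ x, G x ∂densMeasure p) - ε ^ 3 * w) *
        ENNReal.ofReal (1 + ε ^ 2 * ((∫ x, F x ^ 2 ∂densMeasure p) / 2) - ε ^ 3 * r) ≤ 1 := by
  have := hp.isProbabilityMeasure
  let W : EuclideanSpace ℝ (Fin d) → ℝ := fun x =>
    c * (F x ^ 2 + G x ^ 2) + ((2 * F x ^ 2 + 2 * c ^ 2 * G x ^ 2) +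
        (2 * F x ^ 2 + 2 * c ^ 2 * G x ^ 2) ^ 2)
  have iF := hp.integrable_of_hasTemperateGrowth ht hF
  have iG := hp.integrable_of_hasTemperateGrowth ht hG
  have iF2 := hp.integrable_of_hasTemperateGrowth ht (f := fun x => F x ^ 2) (by fun_prop)
  have iF3 := hp.integrable_of_hasTemperateGrowth ht (f := fun x => F x ^ 3) (by fun_prop)
  have iW := hp.integrable_of_hasTemperateGrowth ht (f := W) (by fun_prop)
  have iFG : Integrable (fun x => F x ^ 2 / 2 - c * G x) (densMeasure p) :=
    (iF2.div_const 2).sub (iG.const_mul c)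
  have eFG : ∫ x, (F x ^ 2 / 2 - c * G x) ∂densMeasure p =
      (∫ x, F x ^ 2 ∂densMeasure p) / 2 - c * ∫ x, G x ∂densMeasure p := by
    rw [integral_sub (iF2.div_const 2) (iG.const_mul c), integral_div, integral_const_mul]
  have mF := hF.1.continuous.measurable
  have mG := hG.1.continuous.measurable
  refine ⟨∫ x, W x ∂densMeasure p, (∫ x, F x ^ 3 ∂densMeasure p) / 6, fun ε hε0 hε1 hεK => ?_⟩
  refine le_trans (mul_le_mul' ?_ ?_) (hp.lintegral_exp_mul_lintegral_exp_le
    (f := fun x => ε * F x) (g := fun x => ε * F x - c * ε ^ 2 * G x) (by fun_prop) (by fun_prop)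
    fun x y => ?_)
  · have h := ofReal_combination_le_lintegral_ofReal iF iFG iW
      (v := fun x => Real.exp (ε * F x - c * ε ^ 2 * G x)) (by fun_prop)
      (fun x => (Real.exp_pos _).le) ε (ε ^ 2) (ε ^ 3)
      fun x => exp_second_order_lower_bound hc.le hε0 hε1
    rwa [eFG, hF0, mul_zero, add_zero] at h
  · have h := ofReal_combination_le_lintegral_ofReal iF (iF2.div_const 2) (iF3.div_const 6)
      (v := fun x => Real.exp (-(ε * F x))) (by fun_prop)
      (fun x => (Real.exp_pos _).le) (-ε) (ε ^ 2) (ε ^ 3)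
      fun x => (le_of_eq (by ring)).trans (Real.one_add_add_sq_add_cube_le_exp (-(ε * F x)))
    rwa [integral_div, integral_div, hF0, mul_zero, add_zero] at h
  · have h1 := mul_le_mul_of_nonneg_left (H x y) hε0
    set r := ‖x - y‖
    have h2 : ε * (2 * √(G x) * r) ≤ r ^ 2 / c + c * ε ^ 2 * G x := by
      have h3 : c * (r / c - ε * √(G x)) ^ 2 =
          r ^ 2 / c - 2 * ε * √(G x) * r + c * ε ^ 2 * G x := by
        rw [sub_sq, mul_pow, Real.sq_sqrt (hG0 x)]
        field_simp
      have h4 : 0 ≤ c * (r / c - ε * √(G x)) ^ 2 := by positivity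
      linarith
    have h5 := mul_le_mul_of_nonneg_right hεK (sq_nonneg r)
    have h6 : r ^ 2 / c = 1 / c * r ^ 2 := by ring
    nlinarith

/-- The Poincaré inequality for centered functions of temperate growth, with the squared gradient
replaced by four times a function `G` bounding the first-order increments. -/
lemma integral_sq_le (ht : 0 < t) (hp : IsMoreLogConcaveThanGauss t p)
    {F G : EuclideanSpace ℝ (Fin d) → ℝ} (hF : F.HasTemperateGrowth) (hG : G.HasTemperateGrowth)
    (hG0 : ∀ x, 0 ≤ G x) {K : ℝ}
    (H : ∀ x y, F x - F y ≤ 2 * √(G x) * ‖x - y‖ + K * ‖x - y‖ ^ 2)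
    (hF0 : ∫ x, F x ∂densMeasure p = 0) :
    ∫ x, F x ^ 2 ∂densMeasure p ≤ 4 / t * ∫ x, G x ∂densMeasure p := by
  have main : ∀ c, 4 / t < c →
      ∫ x, F x ^ 2 ∂densMeasure p ≤ c * ∫ x, G x ∂densMeasure p := by
    intro c hct
    have hc : 0 < c := lt_trans (by positivity) hct
    obtain ⟨w, r, hwr⟩ := hp.second_order_bound ht hF hG hG0 H hF0 hc
    set V := ∫ x, F x ^ 2 ∂densMeasure p
    set g := ∫ x, G x ∂densMeasure p
    have hδ : 0 < t / 4 - 1 / c := by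
      rw [sub_pos, div_lt_div_iff₀ hc (by norm_num)]
      rw [div_lt_iff₀ ht] at hct
      linarith
    have small : ∀ φ : ℝ → ℝ, Continuous φ → ∀ a, φ 0 < a → ∀ᶠ ε in nhdsWithin 0 (Set.Ioi 0),
        φ ε < a := fun φ hφ a ha =>
      (hφ.continuousAt.eventually_lt continuousAt_const ha).filter_mono nhdsWithin_le_nhds
    have hev : ∀ᶠ ε in nhdsWithin (0 : ℝ) (Set.Ioi 0),
        (V / 2 - c * g) + V / 2 + ε * (-w - r) +
          ε ^ 2 * ((V / 2 - c * g - ε * w) * (V / 2 - ε * r)) ≤ 0 := by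
      filter_upwards [self_mem_nhdsWithin, small id continuous_id 1 one_pos,
        small (fun ε => ε * K) (by fun_prop) (t / 4 - 1 / c) (by simpa using hδ),
        small (fun ε => -(1 + ε ^ 2 * (V / 2 - c * g) - ε ^ 3 * w)) (by fun_prop) 0 (by simp)]
        with ε hε0 hε1 hεK hP
      have hε0 : 0 < ε := hε0
      have h := hwr ε hε0.le (le_of_lt hε1) hεK.le
      rw [← ENNReal.ofReal_mul (by linarith), ENNReal.ofReal_le_one] at h
      refine nonpos_of_mul_nonpos_right (a := ε ^ 2) ?_ (by positivity)
      linarith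
    have hlim : Tendsto (fun ε : ℝ => (V / 2 - c * g) + V / 2 + ε * (-w - r) +
          ε ^ 2 * ((V / 2 - c * g - ε * w) * (V / 2 - ε * r))) (nhdsWithin 0 (Set.Ioi 0))
        (nhds ((V / 2 - c * g) + V / 2 + 0 * (-w - r) +
          0 ^ 2 * ((V / 2 - c * g - 0 * w) * (V / 2 - 0 * r)))) :=
      (Continuous.tendsto (by fun_prop) 0).mono_left nhdsWithin_le_nhds
    have := le_of_tendsto hlim hev
    linarith
  have hlim : Tendsto (fun c => c * ∫ x, G x ∂densMeasure p) (nhdsWithin (4 / t) (Set.Ioi (4 / t)))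
      (nhds (4 / t * ∫ x, G x ∂densMeasure p)) :=
    (Continuous.tendsto (by fun_prop) _).mono_left nhdsWithin_le_nhds
  exact ge_of_tendsto hlim (eventually_nhdsWithin_of_forall main)

end IsMoreLogConcaveThanGauss

lemma sum_mul_le_of_sq_le {ι : Type*} [Fintype ι] {l : ι → ℝ} (hl : ∀ i, 0 ≤ l i)
    {H : ι → ι → ι → ℝ} (h12 : ∀ i j k, H i j k = H j i k) {s : ℝ} (hs : 0 ≤ s)
    (key : ∀ i, (∑ j, ∑ k, H i j k ^ 2) ^ 2 ≤ s * l i * ∑ j, ∑ k, l j * H i j k ^ 2)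
    {a b q : ℕ} (hq : 3 ≤ q) (hab : a + b = q - 2) :
    ∑ i, ∑ j, ∑ k, l i ^ a * l j ^ b * H i j k ^ 2 ≤ s * ∑ i, l i ^ q := by
  have young : ∀ m n : ℕ, ∑ i, ∑ j, ∑ k, l i ^ m * l j ^ n * H i j k ^ 2 ≤
      ∑ i, ∑ j, ∑ k, l i ^ (m + n) * H i j k ^ 2 := by
    intro m n
    have swap : ∀ f : ι → ι → ℝ, ∑ i, ∑ j, ∑ k, f i j * H i j k ^ 2 =
        ∑ i, ∑ j, ∑ k, f j i * H i j k ^ 2 := by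
      intro f
      rw [Finset.sum_comm]
      refine Finset.sum_congr rfl fun i _ => Finset.sum_congr rfl fun j _ =>
        Finset.sum_congr rfl fun k _ => ?_
      rw [h12 j i k]
    have h1 := swap fun i j => l i ^ m * l j ^ n
    have h2 := swap fun i _ => l i ^ (m + n)
    have h3 : ∑ i, ∑ j, ∑ k, (l i ^ m * l j ^ n) * H i j k ^ 2 +
        ∑ i, ∑ j, ∑ k, (l j ^ m * l i ^ n) * H i j k ^ 2 ≤
        ∑ i, ∑ j, ∑ k, l i ^ (m + n) * H i j k ^ 2 +
        ∑ i, ∑ j, ∑ k, l j ^ (m + n) * H i j k ^ 2 := by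
      simp only [← Finset.sum_add_distrib, ← add_mul]
      refine Finset.sum_le_sum fun i _ => Finset.sum_le_sum fun j _ =>
        Finset.sum_le_sum fun k _ => mul_le_mul_of_nonneg_right ?_ (sq_nonneg _)
      have : 0 ≤ (l i ^ m - l j ^ m) * (l i ^ n - l j ^ n) := by
        rcases le_total (l i) (l j) with h | h
        · exact mul_nonneg_of_nonpos_of_nonpos
            (sub_nonpos.2 (pow_le_pow_left₀ (hl i) h m)) (sub_nonpos.2 (pow_le_pow_left₀ (hl i) h n))
        · exact mul_nonneg
            (sub_nonneg.2 (pow_le_pow_left₀ (hl j) h m)) (sub_nonneg.2 (pow_le_pow_left₀ (hl j) h n))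
      rw [pow_add, pow_add]
      linarith
    linarith
  obtain ⟨q, rfl⟩ : ∃ r, q = r + 3 := ⟨q - 3, by omega⟩
  refine (young a b).trans ?_
  have hab' : a + b = q + 1 := by omega
  rw [hab']
  have hpt : ∀ i, ∑ j, ∑ k, l i ^ (q + 1) * H i j k ^ 2 ≤
      (s * l i ^ (q + 3) + ∑ j, ∑ k, l i ^ q * l j ^ 1 * H i j k ^ 2) / 2 := by
    intro i
    have e1 : ∑ j, ∑ k, l i ^ (q + 1) * H i j k ^ 2 =
        l i ^ (q + 1) * ∑ j, ∑ k, H i j k ^ 2 := by simp only [Finset.mul_sum]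
    have e2 : ∑ j, ∑ k, l i ^ q * l j ^ 1 * H i j k ^ 2 =
        l i ^ q * ∑ j, ∑ k, l j * H i j k ^ 2 := by simp only [Finset.mul_sum, pow_one, mul_assoc]
    rw [e1, e2]
    have hk := key i
    set N := ∑ j, ∑ k, H i j k ^ 2
    set M := ∑ j, ∑ k, l j * H i j k ^ 2 with hM
    have hM0 : 0 ≤ M := Finset.sum_nonneg fun j _ => Finset.sum_nonneg fun k _ =>
      mul_nonneg (hl j) (sq_nonneg _)
    have hli := hl i
    refine le_of_abs_le (abs_le_of_sq_le_sq ?_ (by positivity))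
    have h1 := mul_le_mul_of_nonneg_left hk (pow_nonneg hli (2 * q + 2))
    have h2 := sq_nonneg (s * l i ^ (q + 3) - l i ^ q * M)
    have e3 : (l i ^ (q + 1) * N) ^ 2 = l i ^ (2 * q + 2) * N ^ 2 := by ring
    have e4 : l i ^ (2 * q + 2) * (s * l i * M) = (s * l i ^ (q + 3)) * (l i ^ q * M) := by ring
    rw [e3]
    rw [e4] at h1
    linarith
  have h1 := Finset.sum_le_sum fun i (_ : i ∈ Finset.univ) => hpt i
  have h2 := young q 1
  rw [← Finset.sum_div, Finset.sum_add_distrib, ← Finset.mul_sum] at h1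
  linarith

section Eigenbasis

variable {d : ℕ} {Q : Matrix (Fin d) (Fin d) ℝ}

lemma pow_mulVec_eigenvectorBasis (hQ : Q.IsHermitian) (a : ℕ) (i : Fin d) :
    (Q ^ a) *ᵥ (hQ.eigenvectorBasis i).ofLp =
      hQ.eigenvalues i ^ a • (hQ.eigenvectorBasis i).ofLp := by
  induction a with
  | zero => simp
  | succ a ih =>
    rw [pow_succ, ← mulVec_mulVec, hQ.mulVec_eigenvectorBasis, mulVec_smul, ih, smul_smul, pow_succ,
      mul_comm]

lemma dotProduct_pow_mulVec (hQ : Q.IsHermitian) (a : ℕ) (u w : EuclideanSpace ℝ (Fin d)) :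
    u.ofLp ⬝ᵥ (Q ^ a) *ᵥ w.ofLp = ∑ i, hQ.eigenvalues i ^ a *
      (inner ℝ (hQ.eigenvectorBasis i) u * inner ℝ (hQ.eigenvectorBasis i) w) := by
  have hw : w.ofLp = ∑ i, inner ℝ (hQ.eigenvectorBasis i) w • (hQ.eigenvectorBasis i).ofLp := by
    conv_lhs => rw [← hQ.eigenvectorBasis.sum_repr' w]
    rw [WithLp.ofLp_sum]
    rfl
  rw [hw, mulVec_sum, dotProduct_sum]
  refine Finset.sum_congr rfl fun i _ => ?_
  rw [mulVec_smul, pow_mulVec_eigenvectorBasis, dotProduct_smul, dotProduct_smul]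
  have : u.ofLp ⬝ᵥ (hQ.eigenvectorBasis i).ofLp = inner ℝ (hQ.eigenvectorBasis i) u := by
    simp [EuclideanSpace.inner_eq_star_dotProduct]
  rw [this, smul_eq_mul, smul_eq_mul]
  ring

lemma trace_pow_eq_sum_eigenvalues (hQ : Q.IsHermitian) (a : ℕ) :
    (Q ^ a).trace = ∑ i, hQ.eigenvalues i ^ a := by
  have h : ∀ k, (Q ^ a) k k = ∑ i, hQ.eigenvalues i ^ a * (hQ.eigenvectorBasis i k) ^ 2 := by
    intro k
    have := dotProduct_pow_mulVec hQ a (EuclideanSpace.single k 1) (EuclideanSpace.single k 1)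
    simpa [sq, EuclideanSpace.inner_single_right] using this
  simp only [Matrix.trace, Matrix.diag_apply, h]
  rw [Finset.sum_comm]
  refine Finset.sum_congr rfl fun i _ => ?_
  have h1 := hQ.eigenvectorBasis.norm_eq_one i
  have h2 := EuclideanSpace.norm_sq_eq (hQ.eigenvectorBasis i)
  rw [h1] at h2
  simp only [Real.norm_eq_abs, sq_abs] at h2
  rw [← Finset.mul_sum, ← h2]
  simp

end Eigenbasis

/-- A quadratic form in coordinates along an orthonormal basis has first-order increments bounded
by its half-gradient, up to a quadratic error. -/
lemma quadratic_sub_le {d : ℕ} (v : OrthonormalBasis (Fin d) ℝ (EuclideanSpace ℝ (Fin d)))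
    {B : Fin d → Fin d → ℝ} (hB : ∀ j k, B j k = B k j) (x y : EuclideanSpace ℝ (Fin d)) :
    ∑ j, ∑ k, B j k * (inner ℝ (v j) x * inner ℝ (v k) x) -
        ∑ j, ∑ k, B j k * (inner ℝ (v j) y * inner ℝ (v k) y) ≤
      2 * √(∑ k, (∑ j, B j k * inner ℝ (v j) x) ^ 2) * ‖x - y‖ +
        (∑ j, ∑ k, |B j k|) * ‖x - y‖ ^ 2 := by
  set U : Fin d → ℝ := fun j => inner ℝ (v j) (x - y) with hU
  have hy : ∀ j, inner ℝ (v j) y = inner ℝ (v j) x - U j := fun j => by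
    simp [hU, inner_sub_right]
  have hUn : √(∑ k, U k ^ 2) = ‖x - y‖ := by
    have := v.sum_sq_norm_inner_right (x - y)
    simp only [Real.norm_eq_abs, sq_abs] at this
    rw [hU, this, Real.sqrt_sq (norm_nonneg _)]
  have hU1 : ∀ j, |U j| ≤ ‖x - y‖ := fun j => by
    have := abs_real_inner_le_norm (v j) (x - y)
    rwa [v.norm_eq_one, one_mul] at this
  have hswap : ∑ j, ∑ k, B j k * (U j * inner ℝ (v k) x) =
      ∑ j, ∑ k, B j k * (inner ℝ (v j) x * U k) := by
    rw [Finset.sum_comm]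
    refine Finset.sum_congr rfl fun j _ => Finset.sum_congr rfl fun k _ => ?_
    rw [hB]; ring
  have hgrad : ∑ j, ∑ k, B j k * (inner ℝ (v j) x * U k) =
      ∑ k, (∑ j, B j k * inner ℝ (v j) x) * U k := by
    rw [Finset.sum_comm]
    simp only [Finset.sum_mul, mul_assoc]
  have hexp : ∑ j, ∑ k, B j k * (inner ℝ (v j) x * inner ℝ (v k) x) -
        ∑ j, ∑ k, B j k * (inner ℝ (v j) y * inner ℝ (v k) y) =
      ∑ j, ∑ k, B j k * (inner ℝ (v j) x * U k) + ∑ j, ∑ k, B j k * (U j * inner ℝ (v k) x) +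
        ∑ j, ∑ k, -(B j k * (U j * U k)) := by
    simp only [← Finset.sum_add_distrib, ← Finset.sum_sub_distrib, hy]
    refine Finset.sum_congr rfl fun j _ => Finset.sum_congr rfl fun k _ => ?_
    ring
  have hCS : ∑ k, (∑ j, B j k * inner ℝ (v j) x) * U k ≤
      √(∑ k, (∑ j, B j k * inner ℝ (v j) x) ^ 2) * ‖x - y‖ := by
    rw [← hUn]
    exact Real.sum_mul_le_sqrt_mul_sqrt _ _ _
  have hquad : ∑ j, ∑ k, -(B j k * (U j * U k)) ≤ (∑ j, ∑ k, |B j k|) * ‖x - y‖ ^ 2 := by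
    simp only [Finset.sum_mul]
    refine Finset.sum_le_sum fun j _ => Finset.sum_le_sum fun k _ => ?_
    refine (neg_le_abs _).trans ?_
    rw [abs_mul, abs_mul, sq]
    exact mul_le_mul_of_nonneg_left (mul_le_mul (hU1 j) (hU1 k) (abs_nonneg _) (norm_nonneg _))
      (abs_nonneg _)
  rw [hexp, hswap, hgrad]
  linarith

lemma covMatrix_isHermitian {d : ℕ} (p : EuclideanSpace ℝ (Fin d) → ℝ) :
    (covMatrix p).IsHermitian := by
  ext i j
  simp [covMatrix, Matrix.conjTranspose_apply, mul_comm]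

/-- The coordinates of `x - μ` in an eigenbasis of the covariance matrix, `μ` being the mean. -/
noncomputable def eigenCoord {d : ℕ} (p : EuclideanSpace ℝ (Fin d) → ℝ) (i : Fin d)
    (x : EuclideanSpace ℝ (Fin d)) : ℝ :=
  inner ℝ ((covMatrix_isHermitian p).eigenvectorBasis i) (x - densMean p)

/-- The third moments of a density in an eigenbasis of its covariance matrix. -/
noncomputable def thirdMoment {d : ℕ} (p : EuclideanSpace ℝ (Fin d) → ℝ) (i j k : Fin d) : ℝ :=
  ∫ x, eigenCoord p i x * eigenCoord p j x * eigenCoord p k x ∂densMeasure p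

@[fun_prop]
lemma eigenCoord_hasTemperateGrowth {d : ℕ} (p : EuclideanSpace ℝ (Fin d) → ℝ) (i : Fin d) :
    (eigenCoord p i).HasTemperateGrowth := by
  unfold eigenCoord
  simp only [inner_sub_right]
  fun_prop

namespace IsMoreLogConcaveThanGauss

variable {d : ℕ} {t : ℝ} {p : EuclideanSpace ℝ (Fin d) → ℝ}

lemma integral_eigenCoord (ht : 0 < t) (hp : IsMoreLogConcaveThanGauss t p) (i : Fin d) :
    ∫ x, eigenCoord p i x ∂densMeasure p = 0 := by
  have := hp.isProbabilityMeasure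
  have hid : Integrable (fun x : EuclideanSpace ℝ (Fin d) => x) (densMeasure p) := by
    have h2 := hp.integrable_of_hasTemperateGrowth ht
      (f := fun x : EuclideanSpace ℝ (Fin d) => 1 + ‖x‖ ^ 2) (by fun_prop)
    refine h2.mono' (by fun_prop) (ae_of_all _ fun x => ?_)
    nlinarith [sq_nonneg (‖x‖ - 1)]
  have hsub : Integrable (fun x : EuclideanSpace ℝ (Fin d) => x - densMean p) (densMeasure p) :=
    hid.sub (integrable_const _)
  unfold eigenCoord
  rw [integral_inner hsub, integral_sub hid (integrable_const _), hp.integral_densMeasure]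
  simp [densMean]

lemma integral_eigenCoord_mul (ht : 0 < t) (hp : IsMoreLogConcaveThanGauss t p) (i j : Fin d) :
    ∫ x, eigenCoord p i x * eigenCoord p j x ∂densMeasure p =
      if i = j then (covMatrix_isHermitian p).eigenvalues j else 0 := by
  set hQ := covMatrix_isHermitian p
  set v := hQ.eigenvectorBasis with hv
  have hX : ∀ i x, eigenCoord p i x = ∑ k, v i k * (x k - densMean p k) := by
    intro i x
    simp [eigenCoord, PiLp.inner_apply, v, mul_comm]
  have hco : ∀ k : Fin d,
      (fun x : EuclideanSpace ℝ (Fin d) => x k - densMean p k).HasTemperateGrowth := by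
    intro k
    have : (fun x : EuclideanSpace ℝ (Fin d) => x k - densMean p k) =
        fun x => inner ℝ (EuclideanSpace.single k 1) x - densMean p k := by
      ext x; simp [EuclideanSpace.inner_single_left]
    rw [this]
    fun_prop
  have hcov : ∀ k l, ∫ x, (x k - densMean p k) * (x l - densMean p l) ∂densMeasure p =
      covMatrix p k l := by
    intro k l
    rw [hp.integral_densMeasure]
    rfl
  have hint : ∀ k l, Integrable (fun x : EuclideanSpace ℝ (Fin d) =>
      v i k * v j l * ((x k - densMean p k) * (x l - densMean p l))) (densMeasure p) := fun k l =>
    (hp.integrable_of_hasTemperateGrowth ht ((hco k).mul (hco l))).const_mul _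
  calc ∫ x, eigenCoord p i x * eigenCoord p j x ∂densMeasure p
      = ∫ x, ∑ k, ∑ l, v i k * v j l * ((x k - densMean p k) * (x l - densMean p l))
          ∂densMeasure p := by
        refine integral_congr_ae (ae_of_all _ fun x => ?_)
        simp only [hX, Finset.sum_mul_sum]
        exact Finset.sum_congr rfl fun k _ => Finset.sum_congr rfl fun l _ => by ring
    _ = ∑ k, ∑ l, v i k * v j l * covMatrix p k l := by
        rw [integral_finsetSum _ fun k _ => integrable_finsetSum _ fun l _ => hint k l]
        refine Finset.sum_congr rfl fun k _ => ?_
        rw [integral_finsetSum _ fun l _ => hint k l]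
        exact Finset.sum_congr rfl fun l _ => by rw [integral_const_mul, hcov]
    _ = (v i).ofLp ⬝ᵥ covMatrix p *ᵥ (v j).ofLp := by
        simp only [dotProduct, mulVec, Finset.mul_sum]
        exact Finset.sum_congr rfl fun k _ => Finset.sum_congr rfl fun l _ => by ring
    _ = if i = j then hQ.eigenvalues j else 0 := by
        have := dotProduct_pow_mulVec hQ 1 (v i) (v j)
        rw [pow_one] at this
        rw [this, ← hv]
        by_cases h : i = j <;> simp [v.inner_eq_ite, h, eq_comm (a := j)]

lemma eigenvalues_nonneg (ht : 0 < t) (hp : IsMoreLogConcaveThanGauss t p) (i : Fin d) :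
    0 ≤ (covMatrix_isHermitian p).eigenvalues i := by
  have := hp.integral_eigenCoord_mul ht i i
  rw [if_pos rfl] at this
  rw [← this]
  exact integral_nonneg fun x => mul_self_nonneg _

lemma thirdMoment_sq_sum_le (ht : 0 < t) (hp : IsMoreLogConcaveThanGauss t p) (i : Fin d) :
    (∑ j, ∑ k, thirdMoment p i j k ^ 2) ^ 2 ≤
      4 / t * (covMatrix_isHermitian p).eigenvalues i *
        ∑ j, ∑ k, (covMatrix_isHermitian p).eigenvalues j * thirdMoment p i j k ^ 2 := by
  have := hp.isProbabilityMeasure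
  set l := (covMatrix_isHermitian p).eigenvalues
  set B : Fin d → Fin d → ℝ := fun j k => thirdMoment p i j k with hB
  have hBs : ∀ j k, B j k = B k j := fun j k => by
    simp only [hB, thirdMoment]
    congr 1
    ext x
    ring
  set X := eigenCoord p with hX
  have tX : ∀ i, (X i).HasTemperateGrowth := eigenCoord_hasTemperateGrowth p
  set F₀ : EuclideanSpace ℝ (Fin d) → ℝ := fun x => ∑ j, ∑ k, B j k * (X j x * X k x) with hF₀
  set G : EuclideanSpace ℝ (Fin d) → ℝ := fun x => ∑ k, (∑ j, B j k * X j x) ^ 2 with hG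
  have tF₀ : F₀.HasTemperateGrowth := by
    refine Function.HasTemperateGrowth.sum fun j _ =>
      Function.HasTemperateGrowth.sum fun k _ => ?_
    fun_prop
  have tG : G.HasTemperateGrowth := by
    refine Function.HasTemperateGrowth.sum fun k _ => ?_
    have : (fun x => ∑ j, B j k * X j x).HasTemperateGrowth :=
      Function.HasTemperateGrowth.sum fun j _ => by fun_prop
    fun_prop
  have int {f : EuclideanSpace ℝ (Fin d) → ℝ} (hf : f.HasTemperateGrowth) :
      Integrable f (densMeasure p) := hp.integrable_of_hasTemperateGrowth ht hf
  set m := ∫ x, F₀ x ∂densMeasure p with hm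
  set F : EuclideanSpace ℝ (Fin d) → ℝ := fun x => F₀ x - m with hF
  have tF : F.HasTemperateGrowth := by fun_prop
  have hF0 : ∫ x, F x ∂densMeasure p = 0 := by
    rw [hF, integral_sub (int tF₀) (integrable_const _), ← hm]
    simp
  have poincare := hp.integral_sq_le ht tF tG
    (fun x => Finset.sum_nonneg fun k _ => sq_nonneg _) (K := ∑ j, ∑ k, |B j k|)
    (fun x y => by
      have := quadratic_sub_le (covMatrix_isHermitian p).eigenvectorBasis hBs
        (x - densMean p) (y - densMean p)
      rw [sub_sub_sub_cancel_right] at this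
      simp only [hF, sub_sub_sub_cancel_right]
      exact this) hF0
  have iG : ∫ x, G x ∂densMeasure p = ∑ j, ∑ k, l j * B j k ^ 2 := by
    have e : ∀ x, G x = ∑ k, ∑ j, ∑ j', B j k * B j' k * (X j x * X j' x) := fun x => by
      simp only [hG, sq, Finset.sum_mul_sum]
      exact Finset.sum_congr rfl fun k _ => Finset.sum_congr rfl fun j _ =>
        Finset.sum_congr rfl fun j' _ => by ring
    have hi : ∀ k j j', Integrable (fun x => B j k * B j' k * (X j x * X j' x))
        (densMeasure p) := fun k j j' => int (by fun_prop)
    simp only [e]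
    rw [integral_finsetSum _ fun k _ => integrable_finsetSum _ fun j _ =>
      integrable_finsetSum _ fun j' _ => hi k j j', Finset.sum_comm]
    refine Finset.sum_congr rfl fun k _ => ?_
    rw [integral_finsetSum _ fun j _ => integrable_finsetSum _ fun j' _ => hi k j j']
    refine Finset.sum_congr rfl fun j _ => ?_
    rw [integral_finsetSum _ fun j' _ => hi k j j']
    simp only [integral_const_mul, hX, hp.integral_eigenCoord_mul ht]
    simp
    ring
  have iXF : ∫ x, X i x * F x ∂densMeasure p = ∑ j, ∑ k, B j k ^ 2 := by
    have e : ∀ x, X i x * F x = ∑ j, ∑ k, B j k * (X i x * X j x * X k x) - m * X i x :=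
      fun x => by
        simp only [hF, hF₀, mul_sub, Finset.mul_sum]
        congr 1
        · exact Finset.sum_congr rfl fun k _ => Finset.sum_congr rfl fun j _ => by ring
        · ring
    have hi : ∀ j k, Integrable (fun x => B j k * (X i x * X j x * X k x))
        (densMeasure p) := fun j k => int (by fun_prop)
    simp only [e]
    rw [integral_sub (integrable_finsetSum _ fun j _ => integrable_finsetSum _ fun k _ => hi j k)
      (int (by fun_prop)), integral_const_mul, hX, hp.integral_eigenCoord ht, ← hX, mul_zero,
      sub_zero, integral_finsetSum _ fun j _ => integrable_finsetSum _ fun k _ => hi j k]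
    refine Finset.sum_congr rfl fun j _ => ?_
    rw [integral_finsetSum _ fun k _ => hi j k]
    refine Finset.sum_congr rfl fun k _ => ?_
    rw [integral_const_mul, sq]
    rfl
  have iXX : ∫ x, X i x * X i x ∂densMeasure p = l i := by
    rw [hX, hp.integral_eigenCoord_mul ht, if_pos rfl]
  have hdisc : ∀ s : ℝ, 0 ≤ l i * (s * s) + (-2 * ∑ j, ∑ k, B j k ^ 2) * s +
      ∫ x, F x ^ 2 ∂densMeasure p := by
    intro s
    have h0 : 0 ≤ ∫ x, (F x - s * X i x) ^ 2 ∂densMeasure p := integral_nonneg fun x => sq_nonneg _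
    have e : ∀ x, (F x - s * X i x) ^ 2 =
        F x ^ 2 + (-2 * s) * (X i x * F x) + (s * s) * (X i x * X i x) := fun x => by ring
    have i1 : Integrable (fun x => F x ^ 2) (densMeasure p) := int (by fun_prop)
    have i2 : Integrable (fun x => (-2 * s) * (X i x * F x)) (densMeasure p) := int (by fun_prop)
    have i3 : Integrable (fun x => (s * s) * (X i x * X i x)) (densMeasure p) := int (by fun_prop)
    have i12 : Integrable (fun x => F x ^ 2 + (-2 * s) * (X i x * F x)) (densMeasure p) :=
      i1.add i2
    simp only [e] at h0
    rw [integral_add i12 i3, integral_add i1 i2, integral_const_mul, integral_const_mul,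
      iXF, iXX] at h0
    linarith
  have hCS := discrim_le_zero hdisc
  rw [discrim] at hCS
  have h1 := mul_le_mul_of_nonneg_left poincare (hp.eigenvalues_nonneg ht i)
  rw [iG] at h1
  calc (∑ j, ∑ k, B j k ^ 2) ^ 2 ≤ l i * ∫ x, F x ^ 2 ∂densMeasure p := by linarith
    _ ≤ _ := h1
    _ = _ := by ring

lemma ttensor_pow_eq (ht : 0 < t) (hp : IsMoreLogConcaveThanGauss t p) (a b : ℕ) :
    ttensor p (covMatrix p ^ a) (covMatrix p ^ b) 1 =
      ∑ i, ∑ j, ∑ k, (covMatrix_isHermitian p).eigenvalues i ^ a *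
        (covMatrix_isHermitian p).eigenvalues j ^ b * thirdMoment p i j k ^ 2 := by
  set hQ := covMatrix_isHermitian p
  set l := hQ.eigenvalues
  set X := eigenCoord p with hX
  set Y : Fin d × Fin d × Fin d → EuclideanSpace ℝ (Fin d) → ℝ :=
    fun s x => X s.1 x * X s.2.1 x * X s.2.2 x with hY
  have tX : ∀ i, (X i).HasTemperateGrowth := eigenCoord_hasTemperateGrowth p
  have iY : ∀ s, Integrable (Y s) (densMeasure p) := fun s =>
    hp.integrable_of_hasTemperateGrowth ht (by fun_prop)
  have hform : ∀ (n : ℕ) (x y : EuclideanSpace ℝ (Fin d)),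
      (fun i => x i - densMean p i) ⬝ᵥ (covMatrix p ^ n).mulVec (fun i => y i - densMean p i) =
        ∑ i, l i ^ n * (X i x * X i y) := fun n x y =>
    dotProduct_pow_mulVec hQ n (x - densMean p) (y - densMean p)
  have hint : ∀ x y : EuclideanSpace ℝ (Fin d),
      ((fun i => x i - densMean p i) ⬝ᵥ (covMatrix p ^ a).mulVec (fun i => y i - densMean p i)) *
       ((fun i => x i - densMean p i) ⬝ᵥ (covMatrix p ^ b).mulVec (fun i => y i - densMean p i)) *
       ((fun i => x i - densMean p i) ⬝ᵥ
        (1 : Matrix (Fin d) (Fin d) ℝ).mulVec (fun i => y i - densMean p i)) =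
      ∑ s, l s.1 ^ a * l s.2.1 ^ b * Y s x * Y s y := by
    intro x y
    rw [← pow_zero (covMatrix p), hform, hform, hform, Finset.sum_mul_sum, Finset.sum_mul,
      Fintype.sum_prod_type]
    refine Finset.sum_congr rfl fun i _ => ?_
    rw [Finset.sum_mul_sum, Fintype.sum_prod_type]
    refine Finset.sum_congr rfl fun j _ => Finset.sum_congr rfl fun k _ => ?_
    simp only [hY]
    ring
  have hinner : ∀ x, ∫ y, ∑ s, l s.1 ^ a * l s.2.1 ^ b * Y s x * Y s y ∂densMeasure p =
      ∑ s, l s.1 ^ a * l s.2.1 ^ b * (∫ y, Y s y ∂densMeasure p) * Y s x := by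
    intro x
    rw [integral_finsetSum _ fun s _ => (iY s).const_mul _]
    refine Finset.sum_congr rfl fun s _ => ?_
    rw [integral_const_mul]
    ring
  have hT : ttensor p (covMatrix p ^ a) (covMatrix p ^ b) 1 =
      ∫ x, ∫ y, ∑ s, l s.1 ^ a * l s.2.1 ^ b * Y s x * Y s y ∂densMeasure p ∂densMeasure p := by
    rw [hp.integral_densMeasure, ttensor]
    refine integral_congr_ae (ae_of_all _ fun x => ?_)
    simp only [hint]
    rw [hp.integral_densMeasure, smul_eq_mul, ← integral_const_mul]
    simp only [smul_eq_mul, mul_assoc]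
  rw [hT]
  simp only [hinner]
  rw [integral_finsetSum _ fun s _ => (iY s).const_mul _]
  simp only [integral_const_mul]
  rw [Fintype.sum_prod_type]
  refine Finset.sum_congr rfl fun i _ => ?_
  rw [Fintype.sum_prod_type]
  refine Finset.sum_congr rfl fun j _ => Finset.sum_congr rfl fun k _ => ?_
  rw [mul_assoc, ← sq]
  rfl

lemma ttensor_pow_le (ht : 0 < t) (hp : IsMoreLogConcaveThanGauss t p) {a b q : ℕ} (hq : 3 ≤ q)
    (hab : a + b = q - 2) :
    ttensor p (covMatrix p ^ a) (covMatrix p ^ b) 1 ≤ 4 / t * (covMatrix p ^ q).trace := by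
  rw [hp.ttensor_pow_eq ht, trace_pow_eq_sum_eigenvalues (covMatrix_isHermitian p)]
  refine sum_mul_le_of_sq_le (hp.eigenvalues_nonneg ht) (fun i j k => ?_) (by positivity)
    (hp.thirdMoment_sq_sum_le ht) hq hab
  simp only [thirdMoment]
  congr 1
  ext x
  ring

end IsMoreLogConcaveThanGauss

/-- second bound on the drift `δ_t` of the potential. -/
theorem sum_ttensor_strongly_logconcave_bound {d : ℕ} (t : ℝ) (ht : 0 < t)
    (ϱ : EuclideanSpace ℝ (Fin d) → ℝ) (hϱ : IsMoreLogConcaveThanGauss t ϱ)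
    (hdet : IsUnit (covMatrix ϱ).det) (q : ℕ) (hq : 3 ≤ q) :
    ((q : ℝ) / 2) *
        ∑ a ∈ Finset.range (q - 1),
          ttensor ϱ (covMatrix ϱ ^ a) (covMatrix ϱ ^ (q - 2 - a)) 1 ≤
      (2 * (q : ℝ) ^ 2 / t) * Matrix.trace (covMatrix ϱ ^ q) := by
  have htr : 0 ≤ (covMatrix ϱ ^ q).trace := by
    rw [trace_pow_eq_sum_eigenvalues (covMatrix_isHermitian ϱ)]
    exact Finset.sum_nonneg fun i _ => pow_nonneg (hϱ.eigenvalues_nonneg ht i) q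
  have hsum := Finset.sum_le_card_nsmul (Finset.range (q - 1))
    (fun a => ttensor ϱ (covMatrix ϱ ^ a) (covMatrix ϱ ^ (q - 2 - a)) 1)
    (4 / t * (covMatrix ϱ ^ q).trace) fun a ha => by
      have := Finset.mem_range.1 ha
      exact hϱ.ttensor_pow_le ht hq (by omega)
  rw [Finset.card_range, nsmul_eq_mul] at hsum
  have hcard : ((q - 1 : ℕ) : ℝ) ≤ q := by exact_mod_cast Nat.sub_le q 1
  have hC : 0 ≤ 4 / t * (covMatrix ϱ ^ q).trace := by positivity
  calc (q : ℝ) / 2 * _ ≤ (q : ℝ) / 2 * (q * (4 / t * (covMatrix ϱ ^ q).trace)) :=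
        mul_le_mul_of_nonneg_left (hsum.trans (mul_le_mul_of_nonneg_right hcard hC)) (by positivity)
    _ = _ := by ring
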